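/- Let X be a separable metric space, μ an atomless strictly positive Borel probability measure on X, and A ⊆ B ⊆ C ⊆ X with A an F_σ-set, B and C closed, μ(B) > 0, the set S of isolated points of B contained in A, and B \ S regular closed. Then there exists a sequence x in X such that the set of statistical limit points of x is A, the set of statistical cluster points of x is B, and the set of ordinary limit points of x is C. -/

import Mathlib

open Filter Topology Set
open scoped ENNReal

/-- An ideal on ℕ: contains all finite sets, closed under subsets and finite
unions, and proper. -/
def IsIdeal (I : Set (Set ℕ)) : Prop :=
  (∀ A : Set ℕ, A.Finite → A ∈ I) ∧
  (∀ A B : Set ℕ, A ⊆ B → B ∈ I → A ∈ I) ∧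
  (∀ A B : Set ℕ, A ∈ I → B ∈ I → A ∪ B ∈ I) ∧
  (Set.univ : Set ℕ) ∉ I

/-- `ℓ` is an `I`-limit point of `x`: some subsequence indexed by a set not in
`I` converges to `ℓ`. -/
def ILimitPoint {X : Type*} [TopologicalSpace X] (I : Set (Set ℕ)) (x : ℕ → X) (ℓ : X) : Prop :=
  ∃ A : Set ℕ, A ∉ I ∧ Tendsto x (atTop ⊓ 𝓟 A) (𝓝 ℓ)

/-- `ℓ` is an `I`-cluster point of `x`. -/
def IClusterPoint {X : Type*} [TopologicalSpace X] (I : Set (Set ℕ)) (x : ℕ → X) (ℓ : X) : Prop :=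
  ∀ U ∈ 𝓝 ℓ, {n | x n ∈ U} ∉ I

/-- A lower semicontinuous submeasure on ℕ. -/
def IsLSCSubmeasure (φ : Set ℕ → ℝ≥0∞) : Prop :=
  φ ∅ = 0 ∧ (∀ A B : Set ℕ, A ⊆ B → φ A ≤ φ B) ∧
  (∀ A B : Set ℕ, φ (A ∪ B) ≤ φ A + φ B) ∧
  (∀ A : Set ℕ, Tendsto (fun n => φ (A ∩ Set.Iio n)) atTop (𝓝 (φ A)))

/-- `‖A‖_φ = lim_n φ(A \ {0,…,n-1})`, the limit of an antitone sequence,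
realized as an infimum. -/
noncomputable def phiNorm (φ : Set ℕ → ℝ≥0∞) (A : Set ℕ) : ℝ≥0∞ :=
  ⨅ n : ℕ, φ (A \ Set.Iio n)

/-- The ideal of sets of asymptotic density zero. -/
def I0 : Set (Set ℕ) :=
  {S : Set ℕ | Tendsto (fun n => (Nat.card ↥(S ∩ Set.Iio n) : ℝ) / n) atTop (𝓝 0)}

/-- `u(ℓ) := lim_k ‖{n : x n ∈ U_k}‖_φ` along a decreasing local base at `ℓ`;
its value is independent of the base and equals the infimum over all
neighborhoods. -/
noncomputable def uFun {X : Type*} [TopologicalSpace X] (φ : Set ℕ → ℝ≥0∞)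
    (x : ℕ → X) (ℓ : X) : ℝ≥0∞ :=
  ⨅ U ∈ 𝓝 ℓ, phiNorm φ {n | x n ∈ U}

/-- Isolated points of a set. -/
def isolatedPts {X : Type*} [TopologicalSpace X] (B : Set X) : Set X :=
  {b ∈ B | ∃ U ∈ 𝓝 b, U ∩ B = {b}}


/-! ### Finite frequencies -/

/-- Relative frequency of `S` among the first `n` natural numbers. -/
noncomputable def fr (S : Set ℕ) (n : ℕ) : ℝ := (Nat.card ↥(S ∩ Set.Iio n) : ℝ) / n

lemma mem_I0_iff {S : Set ℕ} : S ∈ I0 ↔ Tendsto (fr S) atTop (𝓝 0) := Iff.rfl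

lemma fin_inter (S : Set ℕ) (n : ℕ) : (S ∩ Set.Iio n).Finite :=
  (Set.finite_Iio n).subset inter_subset_right

lemma fr_nonneg (S : Set ℕ) (n : ℕ) : 0 ≤ fr S n := by unfold fr; positivity

lemma fr_le_of_inter {S T : Set ℕ} {n : ℕ} (h : S ∩ Set.Iio n ⊆ T) : fr S n ≤ fr T n := by
  unfold fr
  have : Nat.card ↥(S ∩ Set.Iio n) ≤ Nat.card ↥(T ∩ Set.Iio n) :=
    Nat.card_mono (fin_inter T n) (subset_inter h inter_subset_right)
  gcongr

lemma fr_mono {S T : Set ℕ} (h : S ⊆ T) (n : ℕ) : fr S n ≤ fr T n :=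
  fr_le_of_inter (inter_subset_left.trans h)

lemma fr_union (S T : Set ℕ) (n : ℕ) : fr (S ∪ T) n ≤ fr S n + fr T n := by
  unfold fr
  rw [← add_div]
  have : Nat.card ↥((S ∪ T) ∩ Set.Iio n)
      ≤ Nat.card ↥(S ∩ Set.Iio n) + Nat.card ↥(T ∩ Set.Iio n) := by
    rw [union_inter_distrib_right]
    simpa using Set.ncard_union_le (S ∩ Set.Iio n) (T ∩ Set.Iio n)
  gcongr
  exact_mod_cast this

lemma fr_Iio (a n : ℕ) : fr (Set.Iio a) n ≤ (a : ℝ) / n := by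
  unfold fr
  have : Nat.card ↥(Set.Iio a ∩ Set.Iio n) ≤ a := by
    have := Nat.card_mono (Set.finite_Iio a) (inter_subset_left (s := Set.Iio a) (t := Set.Iio n))
    simpa using this
  gcongr

lemma fr_Iio_tendsto (a : ℕ) : Tendsto (fr (Set.Iio a)) atTop (𝓝 0) :=
  squeeze_zero (fr_nonneg _) (fr_Iio a) (tendsto_const_div_atTop_nhds_zero_nat _)

lemma fr_sq_tendsto : Tendsto (fr {n | IsSquare n}) atTop (𝓝 0) := by
  have hb : ∀ n : ℕ, fr {n | IsSquare n} n ≤ 1 / Real.sqrt n + 1 / n := by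
    intro n
    rcases Nat.eq_zero_or_pos n with rfl | hn
    · simp [fr]
    have hs : Nat.card ↥({n | IsSquare n} ∩ Set.Iio n) ≤ Nat.sqrt n + 1 := by
      have hsub : ({n | IsSquare n} ∩ Set.Iio n : Set ℕ) ⊆
          Set.image (fun k => k * k) (Set.Iio (Nat.sqrt n + 1)) := by
        rintro m ⟨⟨k, rfl⟩, hm⟩
        refine ⟨k, ?_, rfl⟩
        simp only [Set.mem_Iio] at hm ⊢
        exact Nat.lt_succ_of_le (Nat.le_sqrt.2 hm.le)
      have h1 := Nat.card_mono ((Set.finite_Iio (Nat.sqrt n + 1)).image _) hsub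
      have h2 := Set.ncard_image_le (f := fun k => k * k) (Set.finite_Iio (Nat.sqrt n + 1))
      refine h1.trans (h2.trans ?_)
      simp [← Nat.card_coe_set_eq]
    have hn' : (0 : ℝ) < n := by exact_mod_cast hn
    have hq : (Nat.sqrt n : ℝ) ≤ Real.sqrt n := Real.nat_sqrt_le_real_sqrt
    unfold fr
    have : (Nat.card ↥({n | IsSquare n} ∩ Set.Iio n) : ℝ) ≤ Real.sqrt n + 1 := by
      have : (Nat.card ↥({n | IsSquare n} ∩ Set.Iio n) : ℝ) ≤ Nat.sqrt n + 1 := by exact_mod_cast hs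
      linarith
    calc _ ≤ (Real.sqrt n + 1) / n := by gcongr
      _ = _ := by rw [add_div, Real.sqrt_div_self']
  refine squeeze_zero (fr_nonneg _) hb ?_
  have h1 : Tendsto (fun n : ℕ => 1 / Real.sqrt n) atTop (𝓝 0) := by
    have : Tendsto (fun n : ℕ => Real.sqrt n) atTop atTop :=
      Real.tendsto_sqrt_atTop.comp tendsto_natCast_atTop_atTop
    simp only [one_div]
    exact this.inv_tendsto_atTop
  simpa using h1.add tendsto_one_div_atTop_nhds_zero_nat

lemma not_I0_of_sub {S T Z : Set ℕ} {d : ℝ} (hd : 0 < d) (hS : Tendsto (fr S) atTop (𝓝 d))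
    (hZ : Tendsto (fr Z) atTop (𝓝 0)) (h : S ⊆ Z ∪ T) : T ∉ I0 := by
  intro hT
  rw [mem_I0_iff] at hT
  have := le_of_tendsto_of_tendsto' hS (hZ.add hT)
    (fun n => (fr_mono h n).trans (fr_union _ _ n))
  linarith

lemma I0_mono {S T : Set ℕ} (h : S ⊆ T) (hT : T ∈ I0) : S ∈ I0 :=
  squeeze_zero (fr_nonneg _) (fr_mono h) hT

lemma I0_union {S T : Set ℕ} (hS : S ∈ I0) (hT : T ∈ I0) : S ∪ T ∈ I0 :=
  squeeze_zero (fr_nonneg _) (fr_union S T) (by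
    have := (mem_I0_iff.1 hS).add (mem_I0_iff.1 hT); simpa using this)

/-- statistical limit points are statistical cluster points -/
lemma ILimitPoint.cluster {X : Type*} [TopologicalSpace X] {x : ℕ → X} {l : X}
    (h : ILimitPoint I0 x l) : IClusterPoint I0 x l := by
  obtain ⟨T, hT, hx⟩ := h
  intro U hU hmem
  have := hx hU
  rw [mem_map, mem_inf_principal, mem_atTop_sets] at this
  obtain ⟨N, hN⟩ := this
  refine hT (I0_mono (T := Set.Iio N ∪ {n | x n ∈ U}) ?_ (I0_union (fr_Iio_tendsto N) hmem))
  intro n hn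
  rcases lt_or_ge n N with h | h
  · exact Or.inl h
  · exact Or.inr (hN n h hn)

/-! ### Block structure -/

/-- every natural number is hit infinitely often -/
def gg (m : ℕ) : ℕ := (Nat.unpair m).1

/-- block number -/
def blk (n : ℕ) : ℕ := Nat.log 2 (Nat.log 2 n)

lemma gg_freq (i : ℕ) : ∃ᶠ m in atTop, gg m = i := by
  rw [frequently_atTop]
  intro N
  exact ⟨Nat.pair i N, Nat.right_le_pair i N, by simp [gg]⟩

lemma blk_tendsto : Tendsto blk atTop atTop :=
  have h : Tendsto (Nat.log 2) atTop atTop :=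
    tendsto_atTop_atTop.2 fun b =>
      ⟨2 ^ b, fun _ ha => Nat.le_log_of_pow_le one_lt_two ha⟩
  h.comp h

lemma blk_eq {n m : ℕ} (h1 : 2 ^ 2 ^ m ≤ n) (h2 : n < 2 ^ 2 ^ (m + 1)) : blk n = m := by
  have hn : n ≠ 0 := by
    have : 0 < 2 ^ 2 ^ m := by positivity
    omega
  unfold blk
  have h3 : 2 ^ m ≤ Nat.log 2 n := Nat.le_log_of_pow_le one_lt_two h1
  have h4 : Nat.log 2 n < 2 ^ (m + 1) := Nat.log_lt_of_lt_pow hn h2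
  exact Nat.log_eq_of_pow_le_of_lt_pow h3 h4

lemma dense_clusterPt {X : Type*} [TopologicalSpace X] {y : ℕ → X} {l : X}
    (h : l ∈ closure (range y)) : MapClusterPt l atTop (fun m => y (gg m)) := by
  rw [mapClusterPt_iff_frequently]
  intro s hs
  obtain ⟨_, hz, ⟨i, rfl⟩⟩ := mem_closure_iff_nhds.1 h s hs
  exact (gg_freq i).mono (fun m hm => by rw [hm]; exact hz)

lemma exists_dense_seq {X : Type*} [MetricSpace X] [TopologicalSpace.SeparableSpace X]
    {F : Set X} (hF : F.Nonempty) : ∃ y : ℕ → X, (∀ i, y i ∈ F) ∧ F ⊆ closure (range y) := by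
  have : SecondCountableTopology X := UniformSpace.secondCountable_of_separable X
  have : Nonempty F := hF.to_subtype
  refine ⟨fun i => (TopologicalSpace.denseSeq F i : X), fun i => Subtype.coe_prop _, ?_⟩
  intro z hz
  have h := TopologicalSpace.denseRange_denseSeq F ⟨z, hz⟩
  rw [closure_subtype, ← range_comp] at h
  exact h

open MeasureTheory ProbabilityTheory in
lemma exists_seq {Y : Type*} [MeasurableSpace Y] (ν : Measure Y) [IsProbabilityMeasure ν]
    {𝓔 : Set (Set Y)} (hc : 𝓔.Countable) (hE : ∀ E ∈ 𝓔, MeasurableSet E)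
    {G : Set Y} (hG : ∀ᵐ y ∂ν, y ∈ G) :
    ∃ ω : ℕ → Y, (∀ n, ω n ∈ G) ∧
      ∀ E ∈ 𝓔, Tendsto (fr {n | ω n ∈ E}) atTop (𝓝 (ν.real E)) := by
  set P : Measure (ℕ → Y) := Measure.infinitePi (fun _ => ν) with hP
  have hmp : ∀ i, MeasurePreserving (Function.eval i) P ν :=
    fun i => measurePreserving_eval_infinitePi (fun _ => ν) i
  have h1 : ∀ᵐ ω ∂P, ∀ n, ω n ∈ G := by
    rw [ae_all_iff]
    exact fun n => (hmp n).quasiMeasurePreserving.ae hG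
  have h2 : ∀ᵐ ω ∂P, ∀ E ∈ 𝓔, Tendsto (fr {n | ω n ∈ E}) atTop (𝓝 (ν.real E)) := by
    rw [ae_ball_iff hc]
    intro E hEE
    have hm := hE E hEE
    have hfm : Measurable (E.indicator (fun _ => (1 : ℝ))) := measurable_const.indicator hm
    have hind : iIndepFun (fun i (ω : ℕ → Y) => E.indicator (fun _ => (1 : ℝ)) (ω i)) P :=
      iIndepFun_infinitePi (X := fun _ => E.indicator (fun _ => (1 : ℝ))) (fun _ => hfm)
    have hid : ∀ i, IdentDistrib (fun (ω : ℕ → Y) => E.indicator (fun _ => (1 : ℝ)) (ω i))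
        (fun (ω : ℕ → Y) => E.indicator (fun _ => (1 : ℝ)) (ω 0)) P P := by
      intro i
      have : IdentDistrib (fun ω : ℕ → Y => ω i) (fun ω : ℕ → Y => ω 0) P P :=
        ⟨(measurable_pi_apply i).aemeasurable, (measurable_pi_apply 0).aemeasurable, (hmp i).map_eq.trans (hmp 0).map_eq.symm⟩
      exact this.comp hfm
    have hint : Integrable (fun (ω : ℕ → Y) => E.indicator (fun _ => (1 : ℝ)) (ω 0)) P := by
      have : Integrable (E.indicator (fun _ => (1 : ℝ))) ν :=
        (integrable_const 1).indicator hm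
      exact (hmp 0).integrable_comp_of_integrable this
    have hmean : ∫ ω, E.indicator (fun _ => (1 : ℝ)) (ω 0) ∂P = ν.real E := by
      have := integral_map (μ := P) (φ := fun ω : ℕ → Y => ω 0)
        (measurable_pi_apply 0).aemeasurable
        (f := E.indicator (fun _ => (1 : ℝ))) hfm.aestronglyMeasurable
      rw [← this]
      have h0 : Measure.map (fun ω : ℕ → Y => ω 0) P = ν := (hmp 0).map_eq
      rw [h0, integral_indicator hm]
      simp
    have key := strong_law_ae_real _ hint (fun i j hij => hind.indepFun hij) hid
    rw [hmean] at key
    filter_upwards [key] with ω hω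
    refine hω.congr (fun n => ?_)
    unfold fr
    congr 1
    classical
    have : ({n | ω n ∈ E} ∩ Set.Iio n : Set ℕ) =
        ((Finset.range n).filter (fun i => ω i ∈ E) : Finset ℕ) := by
      ext i; simp [and_comm]
    rw [this, Nat.card_coe_set_eq, Set.ncard_coe_finset]
    simp [Set.indicator_apply, Finset.sum_boole]
  obtain ⟨ω, hω⟩ := (h1.and h2).exists
  exact ⟨ω, hω⟩

lemma core {X : Type*} [MetricSpace X] [TopologicalSpace.SeparableSpace X]
    (A B C O : Set X) (F : ℕ → Set X) (hF : ∀ n, IsClosed (F n)) (hA : A = ⋃ n, F n)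
    (hAB : A ⊆ B) (hBC : B ⊆ C) (hB : IsClosed B) (hC : IsClosed C) (hOB : O ⊆ B)
    (hO : IsOpen O) (hcov : B ⊆ A ∪ closure O) (lab : ℕ → ℕ) (u : ℕ → X) (hu : ∀ n, u n ∈ O)
    (h1 : ∀ k, ∃ d > 0, Tendsto (fr {n | lab n = k}) atTop (𝓝 d))
    (h2 : ∀ ε > 0, ∃ J, ∃ d < ε, Tendsto (fr {n | J ≤ lab n}) atTop (𝓝 d))
    (h3 : ∀ W, IsOpen W → W ⊆ O → W.Nonempty →
      ∃ S ⊆ {n | lab n = 0 ∧ u n ∈ W}, ∃ d > 0, Tendsto (fr S) atTop (𝓝 d))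
    (h4 : ∀ l, ∀ ε > 0, ∃ U ∈ 𝓝 l, ∃ d < ε, Tendsto (fr {n | u n ∈ U}) atTop (𝓝 d)) :
    ∃ x : ℕ → X, {ℓ : X | ILimitPoint I0 x ℓ} = A ∧
      {ℓ : X | IClusterPoint I0 x ℓ} = B ∧
      {ℓ : X | MapClusterPt ℓ atTop x} = C := by
  classical
  obtain ⟨c, hcC, hcd⟩ := exists_dense_seq (F := C) ⟨u 0, hBC (hOB (hu 0))⟩
  have hy : ∀ k, ∃ y : ℕ → X, (F k).Nonempty → (∀ i, y i ∈ F k) ∧ F k ⊆ closure (range y) := by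
    intro k
    by_cases h : (F k).Nonempty
    · obtain ⟨y, hy⟩ := exists_dense_seq h
      exact ⟨y, fun _ => hy⟩
    · exact ⟨u, fun h' => absurd h' h⟩
  choose y hy using hy
  let x : ℕ → X := fun n =>
    if IsSquare n then c (gg (Nat.sqrt n))
    else if lab n = 0 then u n
    else if (F (lab n - 1)).Nonempty then y (lab n - 1) (gg (blk n)) else u n
  have hxsq : ∀ k, x (k * k) = c (gg k) := by
    intro k
    simp [x, Nat.sqrt_eq]
  have hx0 : ∀ n, ¬ IsSquare n → lab n = 0 → x n = u n := by
    intro n hn hl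
    simp [x, hn, hl]
  have hxk : ∀ n k, ¬ IsSquare n → lab n = k + 1 → (F k).Nonempty → x n = y k (gg (blk n)) := by
    intro n k hn hl hk
    simp [x, hn, hl, hk]
  have hxor : ∀ n, ¬ IsSquare n → x n = u n ∨ ∃ k, lab n = k + 1 ∧ x n ∈ F k := by
    intro n hn
    by_cases h0 : lab n = 0
    · exact Or.inl (hx0 n hn h0)
    · obtain ⟨k, hk⟩ := Nat.exists_eq_succ_of_ne_zero h0
      by_cases hne : (F k).Nonempty
      · refine Or.inr ⟨k, hk, ?_⟩
        rw [hxk n k hn hk hne]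
        exact (hy k hne).1 _
      · left
        simp [x, hn, hk, hne]
  have hFA : ∀ k, F k ⊆ A := fun k => hA ▸ subset_iUnion F k
  have hxB : ∀ n, ¬ IsSquare n → x n ∈ B := by
    intro n hn
    rcases hxor n hn with h | ⟨k, -, h⟩
    · rw [h]; exact hOB (hu n)
    · exact hAB (hFA k h)
  have hxC : ∀ n, x n ∈ C := by
    intro n
    by_cases hn : IsSquare n
    · obtain ⟨k, rfl⟩ := hn
      rw [hxsq]; exact hcC _
    · exact hBC (hxB n hn)
  -- points of `A` are statistical limit points
  have hAlim : ∀ l ∈ A, ILimitPoint I0 x l := by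
    intro l hl
    rw [hA, mem_iUnion] at hl
    obtain ⟨k, hk⟩ := hl
    have hne : (F k).Nonempty := ⟨l, hk⟩
    obtain ⟨φ, hφ, hφl⟩ := (dense_clusterPt ((hy k hne).2 hk)).tendsto_subseq
    refine ⟨{n | ¬ IsSquare n ∧ lab n = k + 1 ∧ blk n ∈ range φ}, ?_, ?_⟩
    · intro hT
      rw [mem_I0_iff] at hT
      obtain ⟨d, hd, hlim⟩ := h1 (k + 1)
      have hN : Tendsto (fun r => 2 ^ 2 ^ (φ r + 1)) atTop (atTop : Filter ℕ) := by
        have hp : Tendsto (fun n : ℕ => 2 ^ n) atTop (atTop : Filter ℕ) :=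
          tendsto_pow_atTop_atTop_of_one_lt one_lt_two
        exact hp.comp (hp.comp ((tendsto_add_atTop_nat 1).comp hφ.tendsto_atTop))
      have hbd : ∀ r, fr {n | lab n = k + 1} (2 ^ 2 ^ (φ r + 1)) ≤
          fr {n | ¬ IsSquare n ∧ lab n = k + 1 ∧ blk n ∈ range φ} (2 ^ 2 ^ (φ r + 1)) +
          fr {n | IsSquare n} (2 ^ 2 ^ (φ r + 1)) + 1 / ((2 ^ 2 ^ φ r : ℕ) : ℝ) := by
        intro r
        have e : fr (Set.Iio (2 ^ 2 ^ φ r)) (2 ^ 2 ^ (φ r + 1)) ≤ 1 / ((2 ^ 2 ^ φ r : ℕ) : ℝ) := by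
          refine (fr_Iio _ _).trans (le_of_eq ?_)
          rw [pow_succ 2 (φ r), pow_mul]
          push_cast
          field_simp
        refine le_trans ?_ (add_le_add ((fr_union _ _ _).trans le_rfl) e)
        refine le_trans ?_ (fr_union _ _ _)
        apply fr_le_of_inter
        rintro n ⟨hn, hn2⟩
        by_cases hs : IsSquare n
        · exact Or.inl (Or.inr hs)
        rcases lt_or_ge n (2 ^ 2 ^ φ r) with h | h
        · exact Or.inr h
        · exact Or.inl (Or.inl ⟨hs, hn, r, (blk_eq h hn2).symm⟩)
      have hlast : Tendsto (fun r => 1 / ((2 ^ 2 ^ φ r : ℕ) : ℝ)) atTop (𝓝 0) := by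
        have hp : Tendsto (fun n : ℕ => 2 ^ n) atTop (atTop : Filter ℕ) :=
          tendsto_pow_atTop_atTop_of_one_lt one_lt_two
        exact (tendsto_one_div_atTop_nhds_zero_nat (𝕜 := ℝ)).comp
          (hp.comp (hp.comp hφ.tendsto_atTop))
      have := le_of_tendsto_of_tendsto' (hlim.comp hN)
        (((hT.comp hN).add (fr_sq_tendsto.comp hN)).add hlast) hbd
      linarith
    · intro U hU
      have := hφl hU
      rw [mem_map, mem_atTop_sets] at this
      obtain ⟨R, hR⟩ := this
      rw [mem_map, mem_inf_principal]
      filter_upwards [blk_tendsto.eventually_ge_atTop (φ R)] with n hn hnT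
      obtain ⟨hs, hl, r, hr⟩ := hnT
      show x n ∈ U
      rw [hxk n k hs hl hne, ← hr]
      rw [← hr] at hn
      exact hR r (hφ.le_iff_le.1 hn)
  refine ⟨x, ?_, ?_, ?_⟩
  · refine Subset.antisymm ?_ hAlim
    rintro l ⟨T, hT, hx⟩
    by_contra hlA
    apply hT
    rw [mem_I0_iff, Metric.tendsto_atTop]
    intro ε hε
    obtain ⟨J, d1, hd1, hJ⟩ := h2 (ε / 4) (by positivity)
    obtain ⟨U, hU, d2, hd2, hUd⟩ := h4 l (ε / 4) (by positivity)
    have hV : U ∩ ⋂ k ∈ Set.Iio J, (F k)ᶜ ∈ 𝓝 l := by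
      refine inter_mem hU ((biInter_mem (Set.finite_Iio J)).2 (fun k _ => ?_))
      exact (hF k).isOpen_compl.mem_nhds (fun h => hlA (hFA k h))
    have := hx hV
    rw [mem_map, mem_inf_principal, mem_atTop_sets] at this
    obtain ⟨N, hN⟩ := this
    have hsub : T ⊆ ({n | IsSquare n} ∪ Set.Iio N) ∪ ({n | J ≤ lab n} ∪ {n | u n ∈ U}) := by
      intro n hn
      by_cases hs : IsSquare n
      · exact Or.inl (Or.inl hs)
      rcases lt_or_ge n N with h | h
      · exact Or.inl (Or.inr h)
      right
      rcases le_or_gt J (lab n) with h' | h'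
      · exact Or.inl h'
      right
      have hm := hN n h hn
      rcases hxor n hs with he | ⟨k, hk, he⟩
      · show u n ∈ U
        rw [← he]; exact hm.1
      · have := mem_iInter₂.1 hm.2 k (by simp only [Set.mem_Iio]; omega)
        exact absurd he this
    have hb : ∀ n, fr T n ≤ (fr {n | IsSquare n} n + fr (Set.Iio N) n) +
        (fr {n | J ≤ lab n} n + fr {n | u n ∈ U} n) := fun n =>
      (fr_mono hsub n).trans ((fr_union _ _ n).trans
        (add_le_add (fr_union _ _ n) (fr_union _ _ n)))
    have ht := (fr_sq_tendsto.add (fr_Iio_tendsto N)).add (hJ.add hUd)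
    have hev := ht.eventually (gt_mem_nhds (show 0 + 0 + (d1 + d2) < ε by linarith))
    rw [eventually_atTop] at hev
    obtain ⟨M, hM⟩ := hev
    refine ⟨M, fun n hn => ?_⟩
    rw [Real.dist_eq, sub_zero, abs_of_nonneg (fr_nonneg _ _)]
    exact (hb n).trans_lt (hM n hn)
  · refine Subset.antisymm ?_ ?_
    · intro l hl
      by_contra hlB
      refine hl Bᶜ (hB.isOpen_compl.mem_nhds hlB) (I0_mono (T := {n | IsSquare n}) ?_ fr_sq_tendsto)
      intro n hn
      by_contra hs
      exact hn (hxB n hs)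
    · intro l hl
      rcases hcov hl with h | h
      · exact (hAlim l h).cluster
      · intro U hU
        have hne : (interior U ∩ O).Nonempty :=
          mem_closure_iff_nhds.1 h _ (interior_mem_nhds.2 hU)
        obtain ⟨S, hS, d, hd, hlim⟩ := h3 _ (isOpen_interior.inter hO) inter_subset_right hne
        refine not_I0_of_sub hd hlim fr_sq_tendsto ?_
        intro n hn
        by_cases hs : IsSquare n
        · exact Or.inl hs
        · right
          show x n ∈ U
          rw [hx0 n hs (hS hn).1]
          exact interior_subset (hS hn).2.1
  · refine Subset.antisymm ?_ ?_
    · intro l hl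
      rw [← hC.closure_eq, mem_closure_iff_nhds]
      intro U hU
      obtain ⟨n, hn⟩ := ((mapClusterPt_iff_frequently.1 hl) U hU).exists
      exact ⟨x n, hn, hxC n⟩
    · intro l hl
      have h := dense_clusterPt (hcd hl)
      have hsq : Tendsto (fun k : ℕ => k * k) atTop atTop :=
        tendsto_id.atTop_mul_atTop₀ tendsto_id
      have he : (fun m => c (gg m)) = x ∘ (fun k => k * k) := by
        funext k; exact (hxsq k).symm
      rw [he] at h
      exact h.of_comp hsq

open MeasureTheory ProbabilityTheory in
lemma exists_label_measure : ∃ p : Measure ℕ, IsProbabilityMeasure p ∧ ∀ k, 0 < p {k} := by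
  refine ⟨(geometricPMF (p := 1/2) (by norm_num) (by norm_num)).toMeasure, inferInstance, ?_⟩
  intro k
  rw [PMF.toMeasure_apply_singleton _ _ (measurableSet_singleton k)]
  show 0 < ENNReal.ofReal (geometricPMFReal (1/2) k)
  rw [ENNReal.ofReal_pos]
  unfold geometricPMFReal
  positivity

open MeasureTheory ProbabilityTheory in
lemma exists_data {X : Type*} [MetricSpace X] [TopologicalSpace.SeparableSpace X]
    [MeasurableSpace X] [BorelSpace X] (ν : Measure X) [IsProbabilityMeasure ν]
    (h0 : ∀ x, ν {x} = 0) (O : Set X) (hO : ∀ᵐ x ∂ν, x ∈ O)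
    (hpos : ∀ W, IsOpen W → W ⊆ O → W.Nonempty → 0 < ν W) :
    ∃ (lab : ℕ → ℕ) (u : ℕ → X), (∀ n, u n ∈ O) ∧
    (∀ k, ∃ d > 0, Tendsto (fr {n | lab n = k}) atTop (𝓝 d)) ∧
    (∀ ε > 0, ∃ J, ∃ d < ε, Tendsto (fr {n | J ≤ lab n}) atTop (𝓝 d)) ∧
    (∀ W, IsOpen W → W ⊆ O → W.Nonempty →
      ∃ S ⊆ {n | lab n = 0 ∧ u n ∈ W}, ∃ d > 0, Tendsto (fr S) atTop (𝓝 d)) ∧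
    (∀ l, ∀ ε > 0, ∃ U ∈ 𝓝 l, ∃ d < ε, Tendsto (fr {n | u n ∈ U}) atTop (𝓝 d)) := by
  have : SecondCountableTopology X := UniformSpace.secondCountable_of_separable X
  obtain ⟨p, hp, hpk⟩ := exists_label_measure
  set b := TopologicalSpace.countableBasis X with hb
  have hbb := TopologicalSpace.isBasis_countableBasis X
  have hbm : ∀ U ∈ b, MeasurableSet U := fun U hU => (hbb.isOpen hU).measurableSet
  have hbc : b.Countable := TopologicalSpace.countable_countableBasis X
  let Q : Measure (ℕ × X) := p.prod ν
  let 𝓔 : Set (Set (ℕ × X)) :=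
    (range (fun k : ℕ => ({k} : Set ℕ) ×ˢ (univ : Set X)) ∪
      range (fun J : ℕ => Set.Ici J ×ˢ (univ : Set X))) ∪
    (Set.image (fun U : Set X => ({0} : Set ℕ) ×ˢ U) b ∪
      Set.image (fun U : Set X => (univ : Set ℕ) ×ˢ U) b)
  have hEc : 𝓔.Countable :=
    ((countable_range _).union (countable_range _)).union ((hbc.image _).union (hbc.image _))
  have hEm : ∀ E ∈ 𝓔, MeasurableSet E := by
    rintro E ((⟨k, rfl⟩ | ⟨k, rfl⟩) | (⟨U, hU, rfl⟩ | ⟨U, hU, rfl⟩))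
    · exact (measurableSet_singleton k).prod MeasurableSet.univ
    · exact measurableSet_Ici.prod MeasurableSet.univ
    · exact (measurableSet_singleton 0).prod (hbm U hU)
    · exact MeasurableSet.univ.prod (hbm U hU)
  have hG : ∀ᵐ z ∂Q, z ∈ {z : ℕ × X | z.2 ∈ O} :=
    (Measure.quasiMeasurePreserving_snd (μ := p) (ν := ν)).ae hO
  obtain ⟨ω, hω, hlim⟩ := exists_seq Q hEc hEm hG
  refine ⟨fun n => (ω n).1, fun n => (ω n).2, hω, ?_, ?_, ?_, ?_⟩
  · intro k
    refine ⟨_, ?_, (hlim _ (Or.inl (Or.inl ⟨k, rfl⟩))).congr (fun n => ?_)⟩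
    · rw [gt_iff_lt, measureReal_def, Measure.prod_prod]
      simp only [measure_univ, mul_one]
      exact ENNReal.toReal_pos (hpk k).ne' (measure_ne_top _ _)
    · simp
  · intro ε hε
    have ht : Tendsto (fun J : ℕ => p (Set.Ici J)) atTop (𝓝 0) := by
      have := tendsto_measure_iInter_atTop (μ := p) (s := fun J : ℕ => Set.Ici J)
        (fun J => measurableSet_Ici.nullMeasurableSet) (fun i j hij => Set.Ici_subset_Ici.2 hij)
        ⟨0, measure_ne_top _ _⟩
      have he : (⋂ J : ℕ, Set.Ici J) = ∅ := by
        ext n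
        simp only [mem_iInter, Set.mem_Ici, mem_empty_iff_false, iff_false, not_forall, not_le]
        exact ⟨n + 1, Nat.lt_succ_self n⟩
      rwa [he, measure_empty] at this
    obtain ⟨J, hJ⟩ := (ht.eventually (gt_mem_nhds (ENNReal.ofReal_pos.2 hε))).exists
    refine ⟨J, _, ?_, (hlim _ (Or.inl (Or.inr ⟨J, rfl⟩))).congr (fun n => ?_)⟩
    · rw [measureReal_def, Measure.prod_prod]
      simp only [measure_univ, mul_one]
      exact (ENNReal.lt_ofReal_iff_toReal_lt (measure_ne_top _ _)).1 hJ
    · simp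
  · intro W hW hWO hWne
    obtain ⟨z, hz⟩ := hWne
    obtain ⟨U, hU, hzU, hUW⟩ := hbb.exists_subset_of_mem_open hz hW
    refine ⟨{n | ω n ∈ ({0} : Set ℕ) ×ˢ U}, ?_, _, ?_, hlim _ (Or.inr (Or.inl ⟨U, hU, rfl⟩))⟩
    · rintro n ⟨hn1, hn2⟩
      exact ⟨hn1, hUW hn2⟩
    · rw [gt_iff_lt, measureReal_def, Measure.prod_prod]
      refine ENNReal.toReal_pos (mul_ne_zero (hpk 0).ne' ?_)
        (ENNReal.mul_ne_top (measure_ne_top _ _) (measure_ne_top _ _))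
      exact (hpos U (hbb.isOpen hU) (hUW.trans hWO) ⟨z, hzU⟩).ne'
  · intro l ε hε
    obtain ⟨V, hV, hVo, hVε⟩ := Set.exists_isOpen_lt_of_lt (μ := ν) {l} (ENNReal.ofReal ε)
      (by rw [h0]; exact ENNReal.ofReal_pos.2 hε)
    obtain ⟨U, hU, hzU, hUV⟩ := hbb.exists_subset_of_mem_open (hV rfl) hVo
    refine ⟨U, (hbb.isOpen hU).mem_nhds hzU, _, ?_,
      (hlim _ (Or.inr (Or.inr ⟨U, hU, rfl⟩))).congr (fun n => ?_)⟩
    · rw [measureReal_def, Measure.prod_prod]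
      simp only [measure_univ, one_mul]
      exact (ENNReal.lt_ofReal_iff_toReal_lt (measure_ne_top _ _)).1
        ((measure_mono hUV).trans_lt hVε)
    · simp

/-- realization of prescribed sets of statistical limit points,
statistical cluster points, and ordinary limit points in a separable metric
space carrying an atomless strictly positive Borel probability measure. -/
theorem stmt14 {X : Type*} [MetricSpace X] [TopologicalSpace.SeparableSpace X]
    [MeasurableSpace X] [BorelSpace X]
    (μ : MeasureTheory.Measure X) [MeasureTheory.IsProbabilityMeasure μ]
    (hatomless : ∀ A : Set X, MeasurableSet A → 0 < μ A →
      ∃ B ⊆ A, MeasurableSet B ∧ 0 < μ B ∧ μ B < μ A)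
    (hpos : ∀ U : Set X, IsOpen U → U.Nonempty → 0 < μ U)
    (A B C : Set X) (hAB : A ⊆ B) (hBC : B ⊆ C)
    (hAFσ : ∃ F : ℕ → Set X, (∀ n, IsClosed (F n)) ∧ A = ⋃ n, F n)
    (hB : IsClosed B) (hC : IsClosed C) (hμB : 0 < μ B)
    (hSA : isolatedPts B ⊆ A)
    (hreg : closure (interior (B \ isolatedPts B)) = B \ isolatedPts B) :
    ∃ x : ℕ → X, {ℓ : X | ILimitPoint I0 x ℓ} = A ∧
      {ℓ : X | IClusterPoint I0 x ℓ} = B ∧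
      {ℓ : X | MapClusterPt ℓ atTop x} = C := by
  have hsc : SecondCountableTopology X := UniformSpace.secondCountable_of_separable X
  obtain ⟨F, hF, hA⟩ := hAFσ
  have h0 : ∀ x : X, μ {x} = 0 := by
    intro x
    by_contra hx
    obtain ⟨D, hD, -, hD0, hD1⟩ := hatomless {x} (measurableSet_singleton x)
      (pos_iff_ne_zero.2 hx)
    rcases Set.subset_singleton_iff_eq.1 hD with h | h
    · simp [h] at hD0
    · simp [h] at hD1
  set O := interior (B \ isolatedPts B) with hOdef
  have hOB : O ⊆ B := interior_subset.trans diff_subset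
  have hOne : O.Nonempty := by
    by_contra hne
    rw [Set.not_nonempty_iff_eq_empty] at hne
    rw [hne, closure_empty] at hreg
    have hsub : B ⊆ isolatedPts B := diff_eq_empty.1 hreg.symm
    have hdisc : DiscreteTopology B := by
      rw [discreteTopology_subtype_iff']
      intro z hz
      obtain ⟨-, U, hU, hUB⟩ := hsub hz
      refine ⟨interior U, isOpen_interior, ?_⟩
      refine Subset.antisymm ((inter_subset_inter_left _ interior_subset).trans hUB.subset) ?_
      rintro _ rfl
      exact ⟨mem_interior_iff_mem_nhds.2 hU, hz⟩
    have hcount : Countable B := TopologicalSpace.separableSpace_iff_countable.1 inferInstance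
    have hBc : B.Countable := hcount
    have : μ B = 0 := by
      rw [← Set.biUnion_of_singleton B]
      exact (MeasureTheory.measure_biUnion_null_iff hBc).2 (fun z _ => h0 z)
    exact hμB.ne' this
  have hO : IsOpen O := isOpen_interior
  have hμO : μ O ≠ 0 := (hpos O hO hOne).ne'
  have hprob : MeasureTheory.IsProbabilityMeasure (ProbabilityTheory.cond μ O) :=
    ProbabilityTheory.cond_isProbabilityMeasure hμO
  obtain ⟨lab, u, hu, g1, g2, g3, g4⟩ := exists_data (ProbabilityTheory.cond μ O)
    (fun x => ProbabilityTheory.cond_absolutelyContinuous (h0 x)) O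
    (ProbabilityTheory.ae_cond_mem hO.measurableSet)
    (by
      intro W hW hWO hWne
      have hWm := hpos W hW hWne
      apply ProbabilityTheory.cond_pos_of_inter_ne_zero hO.measurableSet
      rw [Set.inter_eq_self_of_subset_right hWO]
      exact hWm.ne')
  refine core A B C O F hF hA hAB hBC hB hC hOB hO ?_ lab u hu g1 g2 g3 g4
  intro z hz
  by_cases hs : z ∈ isolatedPts B
  · exact Or.inl (hSA hs)
  · right
    rw [hreg]
    exact ⟨hz, hs⟩
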